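/- For α > 1, σ > 0 and z ∈ ℝ with z² ≥ σ (√α + √(α − 1))², the limit b^∞ of the GAGA hyperparameter sequence b_0 = 0, b_{k+1} = f(b_k) (which equals the least nonnegative fixed point of f(b) = α(σ+b)²/(z² + σ + b)) is given explicitly by b^∞ = 2 α σ² / ( z² − (2α − 1)σ + √( (z² − (2α − 1)σ)² − 4 α (α − 1) σ² ) ), and in particular satisfies α σ²/(z² + σ) ≤ b^∞ ≤ 2 α σ² / ( z² − (2α − 1)σ ). -/

import Mathlib

open Filter
open scoped Topology

/-- The scalar GAGA hyperparameter recursion: `b₀ = 0`,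
`b_{k+1} = α (σ + b_k)² / (z² + σ + b_k)`. -/
noncomputable def gagaB (α σ z : ℝ) : ℕ → ℝ
  | 0 => 0
  | k + 1 => α * (σ + gagaB α σ z k) ^ 2 / (z ^ 2 + σ + gagaB α σ z k)

/-- The GAGA update map is monotone on the nonnegative reals. -/
lemma gaga_map_mono {α σ z x y : ℝ} (hα : 0 < α) (hσ : 0 < σ) (hx : 0 ≤ x) (hxy : x ≤ y) :
    α * (σ + x) ^ 2 / (z ^ 2 + σ + x) ≤ α * (σ + y) ^ 2 / (z ^ 2 + σ + y) := by
  have hz := sq_nonneg z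
  rw [div_le_div_iff₀ (by linarith) (by linarith)]
  have hdiff : 0 ≤ α * ((y - x) * (z ^ 2 * ((σ + x) + (σ + y)) + (σ + x) * (σ + y))) := by
    have : 0 ≤ y - x := by linarith
    have : 0 ≤ y := by linarith
    positivity
  linarith

lemma gagaB_nonneg {α σ z : ℝ} (hα : 0 < α) (hσ : 0 < σ) (k : ℕ) : 0 ≤ gagaB α σ z k := by
  induction k with
  | zero => simp [gagaB]
  | succ k ih =>
    simp only [gagaB]
    positivity

lemma gagaB_monotone {α σ z : ℝ} (hα : 0 < α) (hσ : 0 < σ) : Monotone (gagaB α σ z) := by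
  refine monotone_nat_of_le_succ fun k ↦ ?_
  induction k with
  | zero => exact gagaB_nonneg hα hσ 1
  | succ k ih => exact gaga_map_mono hα hσ (gagaB_nonneg hα hσ k) ih

/-- The GAGA sequence converges to the least nonnegative fixed point of its update map. -/
lemma tendsto_gagaB_of_isLeast {α σ z B : ℝ} (hα : 0 < α) (hσ : 0 < σ)
    (hB : IsLeast {b : ℝ | 0 ≤ b ∧ α * (σ + b) ^ 2 / (z ^ 2 + σ + b) = b} B) :
    Tendsto (gagaB α σ z) atTop (𝓝 B) := by
  obtain ⟨⟨hB0, hBfix⟩, hleast⟩ := hB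
  have hle : ∀ k, gagaB α σ z k ≤ B := by
    intro k
    induction k with
    | zero => exact hB0
    | succ k ih => exact (gaga_map_mono hα hσ (gagaB_nonneg hα hσ k) ih).trans_eq hBfix
  obtain ⟨L, hL⟩ : ∃ L, Tendsto (gagaB α σ z) atTop (𝓝 L) :=
    ⟨_, tendsto_atTop_ciSup (gagaB_monotone hα hσ) ⟨B, by rintro _ ⟨k, rfl⟩; exact hle k⟩⟩
  have hL0 : 0 ≤ L := ge_of_tendsto' hL (gagaB_nonneg hα hσ)
  have hLfix : α * (σ + L) ^ 2 / (z ^ 2 + σ + L) = L :=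
    tendsto_nhds_unique
      ((((hL.const_add σ).pow 2).const_mul α).div (hL.const_add (z ^ 2 + σ)) (by positivity))
      (hL.comp (tendsto_add_atTop_nat 1))
  rwa [le_antisymm (hleast ⟨hL0, hLfix⟩) (le_of_tendsto' hL hle)]

/-- Fixed points of the GAGA update map are the roots of a quadratic. -/
lemma gaga_fixed_iff {α σ z b : ℝ} (hσ : 0 < σ) (hb : 0 ≤ b) :
    α * (σ + b) ^ 2 / (z ^ 2 + σ + b) = b ↔
      (α - 1) * b ^ 2 - (z ^ 2 - (2 * α - 1) * σ) * b + α * σ ^ 2 = 0 := by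
  rw [div_eq_iff (by positivity)]
  constructor <;> intro h <;> linarith

/-- For `α > 1`, `σ > 0` and `z² ≥ σ(√α + √(α−1))²`, the limit `b^∞` of the GAGA
hyperparameter sequence (which is the least nonnegative fixed point of the update map)
equals `2ασ²/(z² − (2α−1)σ + √((z² − (2α−1)σ)² − 4α(α−1)σ²))`, and satisfies
`ασ²/(z²+σ) ≤ b^∞ ≤ 2ασ²/(z² − (2α−1)σ)`. -/
theorem gaga_limit_formula (α σ z : ℝ) (hα : 1 < α) (hσ : 0 < σ)
    (hz : σ * (Real.sqrt α + Real.sqrt (α - 1)) ^ 2 ≤ z ^ 2) :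
    ∃ B : ℝ,
      B = 2 * α * σ ^ 2 /
        (z ^ 2 - (2 * α - 1) * σ +
          Real.sqrt ((z ^ 2 - (2 * α - 1) * σ) ^ 2 - 4 * α * (α - 1) * σ ^ 2)) ∧
      IsLeast {b : ℝ | 0 ≤ b ∧ α * (σ + b) ^ 2 / (z ^ 2 + σ + b) = b} B ∧
      Tendsto (gagaB α σ z) atTop (𝓝 B) ∧
      α * σ ^ 2 / (z ^ 2 + σ) ≤ B ∧
      B ≤ 2 * α * σ ^ 2 / (z ^ 2 - (2 * α - 1) * σ) := by
  have hα0 : 0 < α := by linarith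
  have hα1 : 0 < α - 1 := by linarith
  set d := z ^ 2 - (2 * α - 1) * σ with hd
  set s := Real.sqrt (d ^ 2 - 4 * α * (α - 1) * σ ^ 2) with hs
  have hr : 0 < Real.sqrt α * Real.sqrt (α - 1) := by positivity
  have hr2 : (Real.sqrt α * Real.sqrt (α - 1)) ^ 2 = α * (α - 1) := by
    rw [mul_pow, Real.sq_sqrt hα0.le, Real.sq_sqrt hα1.le]
  have hdr : 2 * σ * (Real.sqrt α * Real.sqrt (α - 1)) ≤ d := by
    rw [add_sq, Real.sq_sqrt hα0.le, Real.sq_sqrt hα1.le] at hz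
    linarith
  have hd0 : 0 < d := lt_of_lt_of_le (by positivity) hdr
  have hdisc : 0 ≤ d ^ 2 - 4 * α * (α - 1) * σ ^ 2 := by
    have h := pow_le_pow_left₀ (by positivity) hdr 2
    rw [mul_pow, hr2] at h
    linarith
  have hs0 : 0 ≤ s := Real.sqrt_nonneg _
  have hs2 : s ^ 2 = d ^ 2 - 4 * α * (α - 1) * σ ^ 2 := Real.sq_sqrt hdisc
  have hds : 0 < d + s := by linarith
  obtain ⟨B, hB⟩ : ∃ B, B = 2 * α * σ ^ 2 / (d + s) := ⟨_, rfl⟩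
  have hB0 : 0 ≤ B := by rw [hB]; positivity
  have hBmul : B * (d + s) = 2 * α * σ ^ 2 := by rw [hB]; field_simp
  have hBs : 2 * (α - 1) * B = d - s := by
    refine mul_right_cancel₀ hds.ne' ?_
    linear_combination 2 * (α - 1) * hBmul + hs2
  have hBfix : α * (σ + B) ^ 2 / (z ^ 2 + σ + B) = B := by
    rw [gaga_fixed_iff hσ hB0, ← hd]
    linear_combination (B / 2) * hBs - hBmul / 2
  have hleast : IsLeast {b : ℝ | 0 ≤ b ∧ α * (σ + b) ^ 2 / (z ^ 2 + σ + b) = b} B := by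
    refine ⟨⟨hB0, hBfix⟩, fun b ⟨hb0, hb⟩ ↦ ?_⟩
    rw [gaga_fixed_iff hσ hb0, ← hd] at hb
    rw [gaga_fixed_iff hσ hB0, ← hd] at hBfix
    by_contra! hlt
    have hfac : 0 < (B - b) * (d - (α - 1) * (b + B)) := by
      have := mul_lt_mul_of_pos_left hlt hα1
      exact mul_pos (by linarith) (by linarith)
    linarith
  refine ⟨B, hB, hleast, tendsto_gagaB_of_isLeast hα0 hσ hleast, ?_, ?_⟩
  · simpa [hBfix] using gaga_map_mono (z := z) hα0 hσ le_rfl hB0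
  · rw [hB]
    exact div_le_div_of_nonneg_left (by positivity) hd0 (by linarith)
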